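/- For every odd prime p there exists a prime number q that is a primitive root modulo p, i.e. the residue class of q in ℤ/pℤ is a unit and generates the multiplicative group (ℤ/pℤ)ˣ. -/

import Mathlib

/-- For every odd prime `p` there exists a prime number `q` that is a primitive root
modulo `p`: the residue class of `q` in `ℤ/pℤ` is a unit that generates `(ℤ/pℤ)ˣ`. -/
theorem exists_prime_primitive_root (p : ℕ) (hp : p.Prime) (hodd : Odd p) :
    ∃ q : ℕ, q.Prime ∧ ∃ u : (ZMod p)ˣ, (u : ZMod p) = (q : ZMod p) ∧
      ∀ v : (ZMod p)ˣ, v ∈ Subgroup.zpowers u := by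
  have : Fact p.Prime := ⟨hp⟩
  obtain ⟨u, hu⟩ := IsCyclic.exists_generator (α := (ZMod p)ˣ)
  obtain ⟨q, -, hq, hqu⟩ := Nat.forall_exists_prime_gt_and_eq_mod u.isUnit 0
  exact ⟨q, hq, u, hqu.symm, hu⟩
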